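/- For closure spaces (X,c) and (Y,d), the assignment ζ ↦ (B ↦ c(ζ*(B))) is a bijection between the set of closed continuous relations ζ : (X,c) ⇸ (Y,d) and the set of sup-preserving maps C(Y,d) → C(X,c). -/

import Mathlib

universe u v

/-- The inverse-image operator `ζ*` of a relation `ζ ⊆ X × Y`. -/
def relStar {X Y : Type*} (ζ : Set (X × Y)) (B : Set Y) : Set X :=
  {x : X | ∃ y ∈ B, (x, y) ∈ ζ}

theorem relStar_mono {X Y : Type*} (ζ : Set (X × Y)) {B B' : Set Y} (h : B ⊆ B') :
    relStar ζ B ⊆ relStar ζ B' := by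
  rintro x ⟨y, hy, hxy⟩
  exact ⟨y, h hy, hxy⟩

theorem relStar_iUnion {X Y ι : Type*} (ζ : Set (X × Y)) (B : ι → Set Y) :
    relStar ζ (⋃ i, B i) = ⋃ i, relStar ζ (B i) := by
  ext x
  simp only [relStar, Set.mem_iUnion, Set.mem_ofPred_eq]
  grind

theorem relStar_singleton {X Y : Type*} (ζ : Set (X × Y)) (y : Y) :
    relStar ζ {y} = {x : X | (x, y) ∈ ζ} := by
  ext x
  simp [relStar]

/-- A closure operator absorbs the closures of the members of a union. -/
theorem closure_iUnion_closure {X ι : Type*} {c : Set X → Set X}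
    (hmono : ∀ A B : Set X, A ⊆ B → c A ⊆ c B) (hext : ∀ A : Set X, A ⊆ c A)
    (hidem : ∀ A : Set X, c (c A) = c A) (A : ι → Set X) :
    c (⋃ i, c (A i)) = c (⋃ i, A i) := by
  apply Set.Subset.antisymm
  · rw [← hidem (⋃ i, A i)]
    exact hmono _ _ (Set.iUnion_subset fun i => hmono _ _ (Set.subset_iUnion A i))
  · exact hmono _ _ (Set.iUnion_mono fun i => hext (A i))

/-- For a continuous relation, the closed inverse image does not see the closure. -/
theorem closure_relStar_closure {X Y : Type*} {c : Set X → Set X} {d : Set Y → Set Y}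
    (hcmono : ∀ A B : Set X, A ⊆ B → c A ⊆ c B) (hcidem : ∀ A : Set X, c (c A) = c A)
    (hdext : ∀ A : Set Y, A ⊆ d A) {ζ : Set (X × Y)}
    (hζ : ∀ B : Set Y, relStar ζ (d B) ⊆ c (relStar ζ B)) (B : Set Y) :
    c (relStar ζ (d B)) = c (relStar ζ B) := by
  apply Set.Subset.antisymm
  · rw [← hcidem (relStar ζ B)]
    exact hcmono _ _ (hζ B)
  · exact hcmono _ _ (relStar_mono ζ (hdext B))

/-- For closure spaces `(X, c)` and `(Y, d)`, the assignment
`ζ ↦ (B ↦ c (ζ* B))` is a bijection between closed continuous relations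
`ζ : (X,c) ⇸ (Y,d)` and sup-preserving maps `C(Y,d) → C(X,c)`. -/
theorem closed_continuous_relations_biject_supPreserving {X : Type v} {Y : Type u}
    (c : Set X → Set X) (d : Set Y → Set Y)
    (hcmono : ∀ A B : Set X, A ⊆ B → c A ⊆ c B)
    (hcext : ∀ A : Set X, A ⊆ c A)
    (hcidem : ∀ A : Set X, c (c A) = c A)
    (hdmono : ∀ A B : Set Y, A ⊆ B → d A ⊆ d B)
    (hdext : ∀ A : Set Y, A ⊆ d A)
    (hdidem : ∀ A : Set Y, d (d A) = d A) :
    Set.BijOn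
      (fun (ζ : Set (X × Y)) =>
        fun (B : {B : Set Y // d B = B}) =>
          (⟨c (relStar ζ B.1), hcidem _⟩ : {A : Set X // c A = A}))
      {ζ : Set (X × Y) |
        (∀ B : Set Y, relStar ζ (d B) ⊆ c (relStar ζ B)) ∧
        (∀ y : Y, c {x : X | (x, y) ∈ ζ} = {x : X | (x, y) ∈ ζ})}
      {f : {B : Set Y // d B = B} → {A : Set X // c A = A} |
        ∀ (ι : Type u) (B : ι → {B : Set Y // d B = B}),
          f ⟨d (⋃ i, (B i).1), hdidem _⟩ = ⟨c (⋃ i, (f (B i)).1), hcidem _⟩} := by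
  refine ⟨?_, ?_, ?_⟩
  · rintro ζ ⟨hζ, -⟩ ι B
    apply Subtype.ext
    change c (relStar ζ (d (⋃ i, (B i).1))) = c (⋃ i, c (relStar ζ (B i).1))
    rw [closure_relStar_closure hcmono hcidem hdext hζ, relStar_iUnion,
      closure_iUnion_closure hcmono hcext hcidem]
  · have fiber_eq : ∀ ζ : Set (X × Y), (∀ B : Set Y, relStar ζ (d B) ⊆ c (relStar ζ B)) →
        (∀ y : Y, c {x : X | (x, y) ∈ ζ} = {x : X | (x, y) ∈ ζ}) →
        ∀ y : Y, c (relStar ζ (d {y})) = {x : X | (x, y) ∈ ζ} := by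
      intro ζ hζ hclosed y
      rw [closure_relStar_closure hcmono hcidem hdext hζ, relStar_singleton, hclosed]
    rintro ζ ⟨hζ, hζc⟩ ξ ⟨hξ, hξc⟩ h
    have key : ∀ y : Y, {x : X | (x, y) ∈ ζ} = {x : X | (x, y) ∈ ξ} := by
      intro y
      rw [← fiber_eq ζ hζ hζc y, ← fiber_eq ξ hξ hξc y]
      exact congrArg Subtype.val (congrFun h ⟨d {y}, hdidem _⟩)
    ext ⟨x, y⟩
    exact Set.ext_iff.mp (key y) x
  · intro f hf
    let ζ : Set (X × Y) := {p | p.1 ∈ (f ⟨d {p.2}, hdidem _⟩).1}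
    have key : ∀ B : Set Y, c (relStar ζ B) = (f ⟨d B, hdidem B⟩).1 := by
      intro B
      have hstar : relStar ζ B = ⋃ y : B, (f ⟨d {y.1}, hdidem _⟩).1 := by
        ext x
        rw [Set.mem_iUnion]
        exact ⟨fun ⟨y, hy, hx⟩ => ⟨⟨y, hy⟩, hx⟩, fun ⟨y, hx⟩ => ⟨y.1, y.2, hx⟩⟩
      have hunion : d (⋃ y : B, d {y.1}) = d B := by
        rw [closure_iUnion_closure hdmono hdext hdidem, Set.iUnion_of_singleton_coe]
      have hsup := congrArg Subtype.val (hf B fun y => ⟨d {y.1}, hdidem _⟩)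
      rw [hstar]
      refine hsup.symm.trans ?_
      simp only [hunion]
    refine ⟨ζ, ⟨fun B => ?_, fun y => (f ⟨d {y}, hdidem _⟩).2⟩, ?_⟩
    · have h : c (relStar ζ (d B)) = c (relStar ζ B) := by
        rw [key, key]
        simp only [hdidem]
      exact h ▸ hcext _
    · funext B
      apply Subtype.ext
      change c (relStar ζ B.1) = (f B).1
      rw [key]
      congr 2
      exact Subtype.ext B.2
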